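/- Let (X,𝒜,μ) be a bounded charge space, let ℳ := {A ∈ 𝒜 : μ(A) = 0} be the kernel of μ (a Boolean ideal of 𝒜), and suppose φ : 𝒜/ℳ → 𝒫(Y) is a representation of the quotient Boolean algebra 𝒜/ℳ (an injective Boolean algebra homomorphism into the powerset of a set Y). Write ⟨A⟩ := φ([A]) for A ∈ 𝒜, and define the charge μ on the field of sets ⟨𝒜⟩ := {⟨A⟩ : A ∈ 𝒜} by μ⟨A⟩ := μ(A). Then L1(X,𝒜,μ) is complete (with respect to the pseudonorm ‖f‖₁ = ∫|f| dμ) if and only if (Y, \overline{⟨𝒜⟩}, μ̄) is a measure space, i.e., \overline{⟨𝒜⟩} is a σ-field and μ̄ is countably additive on it, where (Y, \overline{⟨𝒜⟩}, μ̄) is the Peano-Jordan completion of (Y, ⟨𝒜⟩, μ). -/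

import Mathlib

open Filter Set Topology

section ChargeDefs

variable {X : Type*}

/-- A field of sets on `X`: contains `∅`, closed under complements and finite unions. -/
structure IsSetField (𝒜 : Set (Set X)) : Prop where
  empty_mem : (∅ : Set X) ∈ 𝒜
  compl_mem : ∀ A ∈ 𝒜, Aᶜ ∈ 𝒜
  union_mem : ∀ A ∈ 𝒜, ∀ B ∈ 𝒜, A ∪ B ∈ 𝒜

/-- A (bounded, non-negative) charge space: a field of sets together with a finitely
additive non-negative real-valued set function vanishing on `∅`.  (The function `μ` is
given on all of `𝒫(X)`; only its values on `𝒜` are constrained or used.) -/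
structure IsCharge (𝒜 : Set (Set X)) (μ : Set X → ℝ) : Prop where
  isSetField : IsSetField 𝒜
  empty : μ ∅ = 0
  nonneg : ∀ A ∈ 𝒜, 0 ≤ μ A
  additive : ∀ A ∈ 𝒜, ∀ B ∈ 𝒜, Disjoint A B → μ (A ∪ B) = μ A + μ B

/-- The outer charge `μ*(A) = inf {μ B : B ∈ 𝒜, A ⊆ B}`. -/
noncomputable def outerCharge (𝒜 : Set (Set X)) (μ : Set X → ℝ) (A : Set X) : ℝ :=
  sInf (μ '' {B | B ∈ 𝒜 ∧ A ⊆ B})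

/-- A null function: `μ*({x : |h x| > ε}) = 0` for every `ε > 0`. -/
def IsNullFn (𝒜 : Set (Set X)) (μ : Set X → ℝ) (h : X → ℝ) : Prop :=
  ∀ ε > (0 : ℝ), outerCharge 𝒜 μ {x | ε < |h x|} = 0

/-- `f = g` almost everywhere: `f - g` is a null function. -/
def EqAE (𝒜 : Set (Set X)) (μ : Set X → ℝ) (f g : X → ℝ) : Prop :=
  IsNullFn 𝒜 μ (fun x => f x - g x)

/-- `f ≤ g` almost everywhere: `f ≤ g + h` for some null function `h`. -/
def LeAE (𝒜 : Set (Set X)) (μ : Set X → ℝ) (f g : X → ℝ) : Prop :=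
  ∃ h : X → ℝ, IsNullFn 𝒜 μ h ∧ ∀ x, f x ≤ g x + h x

/-- Hazy convergence of a sequence of functions. -/
def HazyConv (𝒜 : Set (Set X)) (μ : Set X → ℝ) (fn : ℕ → X → ℝ) (f : X → ℝ) : Prop :=
  ∀ ε > (0 : ℝ), Tendsto (fun n => outerCharge 𝒜 μ {x | ε < |fn n x - f x|}) atTop (𝓝 0)

/-- A simple function w.r.t. the field `𝒜`: `Σ c_k 1_{A_k}` for a finite partition
`{A_k} ⊆ 𝒜` of `X`. -/
def IsSimpleFn (𝒜 : Set (Set X)) (f : X → ℝ) : Prop :=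
  ∃ (n : ℕ) (c : Fin n → ℝ) (A : Fin n → Set X),
    (∀ k, A k ∈ 𝒜) ∧ (Pairwise fun i j => Disjoint (A i) (A j)) ∧
    (⋃ k, A k) = Set.univ ∧ ∀ x, f x = ∑ k, (A k).indicator (fun _ => c k) x

/-- `T₁`-measurability: `f` is the hazy limit of a sequence of simple functions.
`MemL0 𝒜 μ f` says `f ∈ L₀(X,𝒜,μ)`. -/
def MemL0 (𝒜 : Set (Set X)) (μ : Set X → ℝ) (f : X → ℝ) : Prop :=
  ∃ fn : ℕ → X → ℝ, (∀ n, IsSimpleFn 𝒜 (fn n)) ∧ HazyConv 𝒜 μ fn f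

/-- Integral of a simple function: `Σ_y y·μ(f⁻¹{y})` (a finite sum for simple `f`;
for a simple function `Σ c_k 1_{A_k}` over a partition this equals `Σ c_k μ(A_k)`). -/
noncomputable def sIntegral (μ : Set X → ℝ) (f : X → ℝ) : ℝ :=
  ∑ᶠ y, y * μ (f ⁻¹' {y})

/-- A determining sequence for `f`: simple functions converging hazily to `f` with
`∫ |f_n - f_m| dμ → 0` as `m, n → ∞`. -/
def IsDetermining (𝒜 : Set (Set X)) (μ : Set X → ℝ) (fn : ℕ → X → ℝ) (f : X → ℝ) : Prop :=
  (∀ n, IsSimpleFn 𝒜 (fn n)) ∧ HazyConv 𝒜 μ fn f ∧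
    Tendsto (fun mn : ℕ × ℕ => sIntegral μ (fun x => |fn mn.1 x - fn mn.2 x|)) atTop (𝓝 0)

/-- Integrability w.r.t. a charge: existence of a determining sequence.
`MemL1 𝒜 μ f` says `f ∈ L₁(X,𝒜,μ)`. -/
def MemL1 (𝒜 : Set (Set X)) (μ : Set X → ℝ) (f : X → ℝ) : Prop :=
  ∃ fn : ℕ → X → ℝ, IsDetermining 𝒜 μ fn f

-- The integral `∫ f dμ` of an integrable function: the limit of the integrals of
-- any determining sequence (this limit is independent of the choice).
open Classical in
noncomputable def chargeIntegral (𝒜 : Set (Set X)) (μ : Set X → ℝ) (f : X → ℝ) : ℝ :=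
  if h : ∃ fn : ℕ → X → ℝ, IsDetermining 𝒜 μ fn f then
    limUnder atTop (fun n => sIntegral μ (h.choose n))
  else 0

/-- Smoothness: for every `ε > 0` there is `k > 0` with `μ*({x : |f x| > k}) < ε`. -/
def SmoothFn (𝒜 : Set (Set X)) (μ : Set X → ℝ) (f : X → ℝ) : Prop :=
  ∀ ε > (0 : ℝ), ∃ k > (0 : ℝ), outerCharge 𝒜 μ {x | k < |f x|} < ε

/-- The field of the Peano-Jordan completion of `(X,𝒜,μ)`. -/
def pjField (𝒜 : Set (Set X)) (μ : Set X → ℝ) : Set (Set X) :=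
  {A | ∀ ε > (0 : ℝ), ∃ B ∈ 𝒜, ∃ C ∈ 𝒜, B ⊆ A ∧ A ⊆ C ∧ μ (C \ B) < ε}

/-- The charge of the Peano-Jordan completion: `μ̄(A) = sup {μ B : B ∈ 𝒜, B ⊆ A}`. -/
noncomputable def pjCharge (𝒜 : Set (Set X)) (μ : Set X → ℝ) (A : Set X) : ℝ :=
  sSup (μ '' {B | B ∈ 𝒜 ∧ B ⊆ A})

/-- The pseudometric `d` on `L₀`. -/
noncomputable def hazyDist (𝒜 : Set (Set X)) (μ : Set X → ℝ) (f g : X → ℝ) : ℝ :=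
  sInf {ε : ℝ | 0 < ε ∧ outerCharge 𝒜 μ {x | ε < |f x - g x|} < ε}

/-- `f ∈ L_p(X,𝒜,μ)` for `p ∈ [1,∞)`: `f` is `T₁`-measurable and `|f|^p` integrable. -/
def MemLpC (𝒜 : Set (Set X)) (μ : Set X → ℝ) (p : ℝ) (f : X → ℝ) : Prop :=
  MemL0 𝒜 μ f ∧ MemL1 𝒜 μ (fun x => |f x| ^ p)

/-- `f ∈ L_p` for `p ∈ {0} ∪ [1,∞)`. -/
def MemLp' (𝒜 : Set (Set X)) (μ : Set X → ℝ) (p : ℝ) (f : X → ℝ) : Prop :=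
  if p = 0 then MemL0 𝒜 μ f else MemLpC 𝒜 μ p f

/-- The distance on `L_p`: the pseudometric `d` for `p = 0`, and
`‖f - g‖_p = (∫ |f-g|^p dμ)^(1/p)` for `p ≥ 1`. -/
noncomputable def LpDist (𝒜 : Set (Set X)) (μ : Set X → ℝ) (p : ℝ) (f g : X → ℝ) : ℝ :=
  if p = 0 then hazyDist 𝒜 μ f g
  else (chargeIntegral 𝒜 μ fun x => |f x - g x| ^ p) ^ (1 / p)

/-- The collection of null sets of a charge space. -/
def nullSets (𝒜 : Set (Set X)) (μ : Set X → ℝ) : Set (Set X) :=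
  {A | outerCharge 𝒜 μ A = 0}

/-- The smallest field of sets on `X` containing a given collection `𝒞`. -/
def genSetField (𝒞 : Set (Set X)) : Set (Set X) :=
  ⋂₀ {𝒟 | IsSetField 𝒟 ∧ 𝒞 ⊆ 𝒟}

end ChargeDefs

section Helpers

variable {X : Type*} {𝒜 : Set (Set X)} {μ : Set X → ℝ}

namespace IsSetField

theorem univ_mem (h : IsSetField 𝒜) : (univ : Set X) ∈ 𝒜 := by
  have := h.compl_mem _ h.empty_mem
  simpa using this

theorem inter_mem (h : IsSetField 𝒜) {A B : Set X} (hA : A ∈ 𝒜) (hB : B ∈ 𝒜) : A ∩ B ∈ 𝒜 := by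
  have := h.compl_mem _ (h.union_mem _ (h.compl_mem _ hA) _ (h.compl_mem _ hB))
  simpa [compl_union] using this

theorem diff_mem (h : IsSetField 𝒜) {A B : Set X} (hA : A ∈ 𝒜) (hB : B ∈ 𝒜) : A \ B ∈ 𝒜 := by
  rw [sdiff_eq]
  exact h.inter_mem hA (h.compl_mem _ hB)

theorem biUnion_mem (h : IsSetField 𝒜) {ι : Type*} (T : Finset ι) (A : ι → Set X)
    (hA : ∀ i ∈ T, A i ∈ 𝒜) : (⋃ i ∈ T, A i) ∈ 𝒜 := by
  classical
  induction T using Finset.induction_on with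
  | empty => simpa using h.empty_mem
  | insert a s ha ih =>
    rw [Finset.set_biUnion_insert]
    exact h.union_mem _ (hA _ (by simp)) _ (ih fun i hi => hA i (by simp [hi]))

theorem biUnion_mem_of_finite (h : IsSetField 𝒜) {ι : Type*} {T : Set ι} (hT : T.Finite)
    (A : ι → Set X) (hA : ∀ i ∈ T, A i ∈ 𝒜) : (⋃ i ∈ T, A i) ∈ 𝒜 := by
  have := h.biUnion_mem hT.toFinset A (by simpa using hA)
  simpa using this

end IsSetField

namespace IsCharge

theorem diff_add_inter (h : IsCharge 𝒜 μ) {A B : Set X} (hA : A ∈ 𝒜) (hB : B ∈ 𝒜) :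
    μ (A \ B) + μ (A ∩ B) = μ A := by
  rw [← h.additive _ (h.isSetField.diff_mem hA hB) _ (h.isSetField.inter_mem hA hB),
    sdiff_union_inter]
  exact disjoint_sdiff_inter

theorem diff_of_subset (h : IsCharge 𝒜 μ) {A B : Set X} (hA : A ∈ 𝒜) (hB : B ∈ 𝒜) (hAB : A ⊆ B) :
    μ (B \ A) = μ B - μ A := by
  have := h.diff_add_inter hB hA
  rw [inter_eq_right.2 hAB] at this
  linarith

theorem mono (h : IsCharge 𝒜 μ) {A B : Set X} (hA : A ∈ 𝒜) (hB : B ∈ 𝒜) (hAB : A ⊆ B) :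
    μ A ≤ μ B := by
  have := h.diff_of_subset hA hB hAB
  have := h.nonneg _ (h.isSetField.diff_mem hB hA)
  linarith

theorem union_le (h : IsCharge 𝒜 μ) {A B : Set X} (hA : A ∈ 𝒜) (hB : B ∈ 𝒜) :
    μ (A ∪ B) ≤ μ A + μ B := by
  have h1 := h.additive A hA (B \ A) (h.isSetField.diff_mem hB hA) disjoint_sdiff_right
  rw [union_sdiff_self] at h1
  have := h.mono (h.isSetField.diff_mem hB hA) hB sdiff_subset
  linarith

theorem le_add_diff (h : IsCharge 𝒜 μ) {A B : Set X} (hA : A ∈ 𝒜) (hB : B ∈ 𝒜) :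
    μ A ≤ μ B + μ (A \ B) := by
  have h1 := h.diff_add_inter hA hB
  have := h.mono (h.isSetField.inter_mem hA hB) hB inter_subset_right
  linarith

theorem biUnion_le (h : IsCharge 𝒜 μ) {ι : Type*} (T : Finset ι) (A : ι → Set X)
    (hA : ∀ i ∈ T, A i ∈ 𝒜) : μ (⋃ i ∈ T, A i) ≤ ∑ i ∈ T, μ (A i) := by
  classical
  induction T using Finset.induction_on with
  | empty => simp [h.empty]
  | insert a s ha ih =>
    rw [Finset.set_biUnion_insert, Finset.sum_insert ha]
    have h1 := ih fun i hi => hA i (by simp [hi])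
    have h2 := h.union_le (hA a (by simp))
      (h.isSetField.biUnion_mem s A fun i hi => hA i (by simp [hi]))
    linarith

theorem biUnion_eq (h : IsCharge 𝒜 μ) {ι : Type*} (T : Finset ι) (A : ι → Set X)
    (hA : ∀ i ∈ T, A i ∈ 𝒜) (hd : ∀ i j, i ≠ j → Disjoint (A i) (A j)) :
    μ (⋃ i ∈ T, A i) = ∑ i ∈ T, μ (A i) := by
  classical
  induction T using Finset.induction_on with
  | empty => simp [h.empty]
  | insert a s ha ih =>
    rw [Finset.set_biUnion_insert, Finset.sum_insert ha, h.additive _ (hA a (by simp)) _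
      (h.isSetField.biUnion_mem s A fun i hi => hA i (by simp [hi])),
      ih fun i hi => hA i (by simp [hi])]
    simp only [disjoint_iUnion_right]
    intro i hi
    exact hd _ _ fun e => ha (e ▸ hi)

theorem outer_le (h : IsCharge 𝒜 μ) {A B : Set X} (hB : B ∈ 𝒜) (hAB : A ⊆ B) :
    outerCharge 𝒜 μ A ≤ μ B := by
  apply csInf_le
  · refine ⟨0, ?_⟩
    rintro _ ⟨C, hC, rfl⟩
    exact h.nonneg _ hC.1
  · exact ⟨B, ⟨hB, hAB⟩, rfl⟩

theorem outer_nonneg (h : IsCharge 𝒜 μ) (A : Set X) : 0 ≤ outerCharge 𝒜 μ A := by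
  apply Real.sInf_nonneg
  rintro _ ⟨C, hC, rfl⟩
  exact h.nonneg _ hC.1

theorem exists_of_outer_lt (h : IsCharge 𝒜 μ) {A : Set X} {δ : ℝ}
    (hd : outerCharge 𝒜 μ A < δ) : ∃ B ∈ 𝒜, A ⊆ B ∧ μ B < δ := by
  obtain ⟨_, ⟨B, hB, rfl⟩, h2⟩ := exists_lt_of_csInf_lt
    (⟨_, univ, ⟨h.isSetField.univ_mem, subset_univ _⟩, rfl⟩ :
      (μ '' {B | B ∈ 𝒜 ∧ A ⊆ B}).Nonempty) hd
  exact ⟨B, hB.1, hB.2, h2⟩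

/-- Hazy convergence through covering sets of the field. -/
theorem hazy_iff (h : IsCharge 𝒜 μ) {fn : ℕ → X → ℝ} {f : X → ℝ} :
    HazyConv 𝒜 μ fn f ↔ ∀ ε > (0 : ℝ), ∀ δ > (0 : ℝ), ∃ N, ∀ n ≥ N, ∃ B ∈ 𝒜,
      (∀ x, x ∉ B → |fn n x - f x| ≤ ε) ∧ μ B < δ := by
  constructor
  · intro H ε hε δ hδ
    have := (H ε hε).eventually (gt_mem_nhds hδ)
    obtain ⟨N, hN⟩ := eventually_atTop.1 this
    refine ⟨N, fun n hn => ?_⟩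
    obtain ⟨B, hB, h1, h2⟩ := h.exists_of_outer_lt (hN n hn)
    refine ⟨B, hB, fun x hx => ?_, h2⟩
    by_contra hc
    exact hx (h1 (not_le.1 hc))
  · intro H ε hε
    rw [Metric.tendsto_atTop]
    intro δ hδ
    obtain ⟨N, hN⟩ := H ε hε δ hδ
    refine ⟨N, fun n hn => ?_⟩
    obtain ⟨B, hB, h1, h2⟩ := hN n hn
    rw [Real.dist_eq, sub_zero, abs_of_nonneg (h.outer_nonneg _)]
    refine (h.outer_le hB ?_).trans_lt h2
    intro x hx
    by_contra hc
    exact absurd (h1 x hc) (not_le.2 hx)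

end IsCharge

/-- Finite-valued maps all of whose preimages lie in the field. -/
def SMap (𝒜 : Set (Set X)) {ι : Type*} (P : X → ι) : Prop :=
  (range P).Finite ∧ ∀ S : Set ι, P ⁻¹' S ∈ 𝒜

theorem SMap.comp {ι κ : Type*} {P : X → ι} (hP : SMap 𝒜 P) (g : ι → κ) :
    SMap 𝒜 (fun x => g (P x)) := by
  refine ⟨?_, fun S => hP.2 (g ⁻¹' S)⟩
  have := hP.1.image g
  rwa [← range_comp] at this

theorem SMap.prod (h𝒜 : IsSetField 𝒜) {ι κ : Type*} {P : X → ι} {Q : X → κ} (hP : SMap 𝒜 P)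
    (hQ : SMap 𝒜 Q) : SMap 𝒜 (fun x => (P x, Q x)) := by
  have hfin := hP.1.prod hQ.1
  refine ⟨hfin.subset ?_, fun S => ?_⟩
  · rintro _ ⟨x, rfl⟩
    exact ⟨⟨x, rfl⟩, ⟨x, rfl⟩⟩
  · have : (fun x => (P x, Q x)) ⁻¹' S =
        ⋃ p ∈ (range P ×ˢ range Q) ∩ S, P ⁻¹' {p.1} ∩ Q ⁻¹' {p.2} := by
      ext x
      simp only [mem_preimage, mem_iUnion, mem_inter_iff, mem_singleton_iff, exists_prop]
      constructor
      · intro hx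
        exact ⟨(P x, Q x), ⟨⟨⟨x, rfl⟩, ⟨x, rfl⟩⟩, hx⟩, rfl, rfl⟩
      · rintro ⟨⟨a, b⟩, ⟨-, hs⟩, h1, h2⟩
        simp only at h1 h2
        rwa [h1, h2]
    rw [this]
    exact h𝒜.biUnion_mem_of_finite (hfin.subset inter_subset_left) _
      fun p _ => h𝒜.inter_mem (hP.2 _) (hQ.2 _)

theorem SMap.of_simple (h𝒜 : IsSetField 𝒜) {f : X → ℝ} (hf : IsSimpleFn 𝒜 f) : SMap 𝒜 f := by
  classical
  obtain ⟨n, c, A, hA, hd, hu, hfx⟩ := hf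
  have key : ∀ k, ∀ x ∈ A k, f x = c k := by
    intro k x hx
    rw [hfx, Finset.sum_eq_single k]
    · simp [hx]
    · intro j _ hj
      exact indicator_of_notMem (fun h => (disjoint_left.1 (hd hj)) h hx) _
    · simp
  have cov : ∀ x, ∃ k, x ∈ A k := fun x => by
    have : x ∈ ⋃ k, A k := hu ▸ mem_univ x
    simpa using this
  refine ⟨(finite_range c).subset ?_, fun S => ?_⟩
  · rintro _ ⟨x, rfl⟩
    obtain ⟨k, hk⟩ := cov x
    exact ⟨k, (key k x hk).symm⟩
  · have : f ⁻¹' S = ⋃ k ∈ {k | c k ∈ S}, A k := by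
      ext x
      simp only [mem_preimage, mem_iUnion, exists_prop, mem_ofPred_eq]
      constructor
      · intro hx
        obtain ⟨k, hk⟩ := cov x
        exact ⟨k, key k x hk ▸ hx, hk⟩
      · rintro ⟨k, hk, hx⟩
        rwa [key k x hx]
    rw [this]
    exact h𝒜.biUnion_mem_of_finite (toFinite _) _ fun k _ => hA k

theorem SMap.simple {f : X → ℝ} (hf : SMap 𝒜 f) : IsSimpleFn 𝒜 f := by
  classical
  obtain ⟨hfin, hS⟩ := hf
  have := hfin.fintype
  let e := Fintype.equivFin (range f)
  refine ⟨Fintype.card (range f), fun k => (e.symm k : ℝ), fun k => f ⁻¹' {(e.symm k : ℝ)},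
    fun k => hS _, ?_, ?_, ?_⟩
  · intro i j hij
    rw [Set.disjoint_left]
    intro x hx hy
    simp only [mem_preimage, mem_singleton_iff] at hx hy
    exact hij (e.symm.injective (Subtype.ext (hx.symm.trans hy)))
  · ext x
    simp only [mem_iUnion, mem_preimage, mem_singleton_iff, mem_univ, iff_true]
    exact ⟨e ⟨f x, x, rfl⟩, by simp⟩
  · intro x
    rw [Finset.sum_eq_single (e ⟨f x, x, rfl⟩)]
    · simp
    · intro j _ hj
      apply indicator_of_notMem
      simp only [mem_preimage, mem_singleton_iff]
      intro h
      apply hj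
      rw [← e.symm.injective.eq_iff]
      apply Subtype.ext
      simp [h]
    · simp

theorem SMap.measure_preimage (h : IsCharge 𝒜 μ) {ι : Type*} {P : X → ι} (hP : SMap 𝒜 P)
    (T : Finset ι) (hT : range P ⊆ T) (S : ι → Prop) [DecidablePred S] :
    μ (P ⁻¹' {i | S i}) = ∑ i ∈ T with S i, μ (P ⁻¹' {i}) := by
  rw [← h.biUnion_eq _ _ (fun i _ => hP.2 _)]
  · congr 1
    ext x
    simp only [mem_preimage, mem_ofPred_eq, Finset.mem_filter, mem_iUnion, mem_singleton_iff,
      exists_prop]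
    constructor
    · intro hx
      exact ⟨P x, ⟨hT ⟨x, rfl⟩, hx⟩, rfl⟩
    · rintro ⟨i, ⟨-, hi⟩, rfl⟩
      exact hi
  · intro i j hij
    rw [Set.disjoint_left]
    intro x hx hy
    exact hij (hx.symm.trans hy)

theorem SMap.sInt (h : IsCharge 𝒜 μ) {ι : Type*} {P : X → ι} (hP : SMap 𝒜 P)
    (T : Finset ι) (hT : range P ⊆ T) (g : ι → ℝ) :
    sIntegral μ (fun x => g (P x)) = ∑ i ∈ T, g i * μ (P ⁻¹' {i}) := by
  classical
  unfold sIntegral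
  rw [finsum_eq_sum_of_support_subset (s := T.image g)]
  · rw [← Finset.sum_fiberwise_of_maps_to (t := T.image g) (g := g)
      (fun i hi => Finset.mem_image_of_mem g hi)]
    apply Finset.sum_congr rfl
    intro y _
    have := hP.measure_preimage h T hT (fun i => g i = y)
    have e : (fun x => g (P x)) ⁻¹' {y} = P ⁻¹' {i | g i = y} := rfl
    rw [e, this, Finset.mul_sum]
    apply Finset.sum_congr rfl
    intro i hi
    rw [(Finset.mem_filter.1 hi).2]
  · intro y hy
    by_contra hc
    apply hy
    have : (fun x => g (P x)) ⁻¹' {y} = ∅ := by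
      ext x
      simp only [mem_preimage, mem_singleton_iff, mem_empty_iff_false, iff_false]
      intro hx
      apply hc
      simp only [Finset.coe_image, mem_image]
      exact ⟨P x, hT ⟨x, rfl⟩, hx⟩
    simp [this, h.empty]

section SimpleInt

variable {f g k : X → ℝ}

theorem SMap.add (h : IsSetField 𝒜) (hf : SMap 𝒜 f) (hg : SMap 𝒜 g) :
    SMap 𝒜 (fun x => f x + g x) := (hf.prod h hg).comp fun p => p.1 + p.2

theorem SMap.sub (h : IsSetField 𝒜) (hf : SMap 𝒜 f) (hg : SMap 𝒜 g) :
    SMap 𝒜 (fun x => f x - g x) := (hf.prod h hg).comp fun p => p.1 - p.2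

theorem SMap.abs (hf : SMap 𝒜 f) : SMap 𝒜 (fun x => |f x|) := hf.comp fun p => |p|

theorem SMap.dist (h : IsSetField 𝒜) (hf : SMap 𝒜 f) (hg : SMap 𝒜 g) :
    SMap 𝒜 (fun x => |f x - g x|) := (hf.sub h hg).abs

theorem SMap.const (h : IsSetField 𝒜) (c : ℝ) : SMap 𝒜 (fun _ : X => c) := by
  classical
  refine ⟨(finite_singleton c).subset (range_const_subset), fun S => ?_⟩
  by_cases hc : c ∈ S
  · simpa [preimage_const, hc] using h.univ_mem
  · simpa [preimage_const, hc] using h.empty_mem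

theorem SMap.mem (h : IsSetField 𝒜) {A : Set X} (hA : A ∈ 𝒜) : SMap 𝒜 (fun x => x ∈ A) := by
  refine ⟨toFinite _, fun S => ?_⟩
  by_cases h1 : True ∈ S <;> by_cases h2 : False ∈ S
  · convert h.univ_mem
    ext x
    by_cases hx : x ∈ A <;> simp [hx, h1, h2]
  · convert hA
    ext x
    by_cases hx : x ∈ A <;> simp [hx, h1, h2]
  · convert h.compl_mem _ hA
    ext x
    by_cases hx : x ∈ A <;> simp [hx, h1, h2]
  · convert h.empty_mem
    ext x
    by_cases hx : x ∈ A <;> simp [hx, h1, h2]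

open Classical in
theorem SMap.ind (h : IsSetField 𝒜) {A : Set X} (hA : A ∈ 𝒜) (c : ℝ) :
    SMap 𝒜 (fun x => if x ∈ A then c else 0) :=
  (SMap.mem h hA).comp fun p => if p then c else 0

open Classical in
theorem sInt_ind (h : IsCharge 𝒜 μ) {A : Set X} (hA : A ∈ 𝒜) (c : ℝ) :
    sIntegral μ (fun x => if x ∈ A then c else 0) = c * μ A := by
  have := (SMap.mem h.isSetField hA).sInt h Finset.univ (by intro p _; simp [eq_iff_iff]; tauto) fun p => if p then c else 0
  rw [this]
  have e : (fun x => x ∈ A) ⁻¹' {True} = A := by ext; simp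
  simp [e]

theorem sInt_add (h : IsCharge 𝒜 μ) (hf : SMap 𝒜 f) (hg : SMap 𝒜 g) :
    sIntegral μ (fun x => f x + g x) = sIntegral μ f + sIntegral μ g := by
  have hP := hf.prod h.isSetField hg
  have hT := hP.1.coe_toFinset.symm.subset
  rw [hP.sInt h _ hT fun p => p.1 + p.2]
  have h1 := hP.sInt h _ hT fun p => p.1
  have h2 := hP.sInt h _ hT fun p => p.2
  simp only at h1 h2
  rw [h1, h2, ← Finset.sum_add_distrib]
  simp [add_mul]

theorem sInt_sub (h : IsCharge 𝒜 μ) (hf : SMap 𝒜 f) (hg : SMap 𝒜 g) :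
    sIntegral μ (fun x => f x - g x) = sIntegral μ f - sIntegral μ g := by
  have := sInt_add h (hf.sub h.isSetField hg) hg
  simp only [sub_add_cancel] at this
  linarith

theorem sInt_mono (h : IsCharge 𝒜 μ) (hf : SMap 𝒜 f) (hg : SMap 𝒜 g) (hfg : ∀ x, f x ≤ g x) :
    sIntegral μ f ≤ sIntegral μ g := by
  have hP := hf.prod h.isSetField hg
  have hT := hP.1.coe_toFinset.symm.subset
  have h1 := hP.sInt h _ hT fun p => p.1
  have h2 := hP.sInt h _ hT fun p => p.2
  simp only at h1 h2
  rw [h1, h2]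
  apply Finset.sum_le_sum
  intro i hi
  apply mul_le_mul_of_nonneg_right _ (h.nonneg _ (hP.2 _))
  obtain ⟨x, rfl⟩ := hP.1.mem_toFinset.1 hi
  exact hfg x

theorem sInt_nonneg (h : IsCharge 𝒜 μ) (hf : SMap 𝒜 f) (hf0 : ∀ x, 0 ≤ f x) :
    0 ≤ sIntegral μ f := by
  have hT := hf.1.coe_toFinset.symm.subset
  have h1 := hf.sInt h _ hT fun p => p
  rw [h1]
  apply Finset.sum_nonneg
  intro i hi
  apply mul_nonneg _ (h.nonneg _ (hf.2 _))
  obtain ⟨x, rfl⟩ := hf.1.mem_toFinset.1 hi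
  exact hf0 x

theorem sInt_abs_sub (h : IsCharge 𝒜 μ) (hf : SMap 𝒜 f) (hg : SMap 𝒜 g) :
    |sIntegral μ f - sIntegral μ g| ≤ sIntegral μ (fun x => |f x - g x|) := by
  have h3 := hf.dist h.isSetField hg
  rw [abs_sub_le_iff]
  constructor
  · rw [← sInt_sub h hf hg]
    exact sInt_mono h (hf.sub h.isSetField hg) h3 fun x => le_abs_self _
  · rw [← sInt_sub h hg hf]
    exact sInt_mono h (hg.sub h.isSetField hf) h3 fun x => by
      rw [abs_sub_comm]; exact le_abs_self _

theorem sInt_tri (h : IsCharge 𝒜 μ) (hf : SMap 𝒜 f) (hg : SMap 𝒜 g) (hk : SMap 𝒜 k) :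
    sIntegral μ (fun x => |f x - k x|) ≤
      sIntegral μ (fun x => |f x - g x|) + sIntegral μ (fun x => |g x - k x|) := by
  have s := h.isSetField
  rw [← sInt_add h (hf.dist s hg) (hg.dist s hk)]
  exact sInt_mono h (hf.dist s hk) ((hf.dist s hg).add s (hg.dist s hk)) fun x =>
    abs_sub_le _ _ _

theorem sInt_cheb (h : IsCharge 𝒜 μ) (hf : SMap 𝒜 f) (c : ℝ) :
    c * μ {x | c < |f x|} ≤ sIntegral μ (fun x => |f x|) := by
  classical
  have hm : {x | c < |f x|} ∈ 𝒜 := hf.2 {y | c < |y|}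
  rw [← sInt_ind h hm]
  refine sInt_mono h (SMap.ind h.isSetField hm c) hf.abs fun x => ?_
  split_ifs with hx
  · exact le_of_lt hx
  · exact abs_nonneg _

theorem SMap.bdd (hf : SMap 𝒜 f) : ∃ M, 0 ≤ M ∧ ∀ x, |f x| ≤ M := by
  obtain ⟨M, hM⟩ := hf.abs.1.bddAbove
  exact ⟨max M 0, le_max_right _ _, fun x => (hM ⟨x, rfl⟩).trans (le_max_left _ _)⟩

/-- A Cauchy sequence of simple functions going hazily to zero has integrals going to zero. -/
theorem key_null (h : IsCharge 𝒜 μ) {t : ℕ → X → ℝ} (ht : ∀ n, SMap 𝒜 (t n))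
    (hz : HazyConv 𝒜 μ t (fun _ => 0))
    (hc : ∀ ε > (0 : ℝ), ∃ N, ∀ m ≥ N, ∀ n ≥ N, sIntegral μ (fun x => |t m x - t n x|) < ε) :
    ∀ ε > (0 : ℝ), ∃ N, ∀ n ≥ N, sIntegral μ (fun x => |t n x|) < ε := by
  classical
  intro ε hε
  have s := h.isSetField
  obtain ⟨N, hN⟩ := hc (ε / 3) (by positivity)
  obtain ⟨M, hM0, hM⟩ := (ht N).bdd
  have hX := h.nonneg _ s.univ_mem
  set δ := ε / (3 * (μ univ + 1)) with hδ
  have hδ0 : 0 < δ := by positivity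
  have hδX : δ * μ univ ≤ ε / 3 := by
    rw [hδ, div_mul_eq_mul_div, div_le_div_iff₀ (by positivity) (by positivity)]
    nlinarith
  obtain ⟨N', hN'⟩ := h.hazy_iff.1 hz δ hδ0 (ε / (3 * (M + 1))) (by positivity)
  refine ⟨max N N', fun n hn => ?_⟩
  obtain ⟨B, hB, h1, h2⟩ := hN' n (le_of_max_le_right hn)
  have hn1 := hN n (le_of_max_le_left hn) N le_rfl
  have hd := (ht n).dist s (ht N)
  have hi1 := SMap.ind s s.univ_mem δ
  have hi2 := SMap.ind s hB M
  have h3 : sIntegral μ (fun x => |t n x|) ≤ _ :=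
    sInt_mono h (ht n).abs ((hd.add s hi1).add s hi2) fun x => by
      simp only [mem_univ, if_true]
      split_ifs with hx
      · have := hM x
        have := abs_sub_abs_le_abs_sub (t n x) (t N x)
        linarith
      · have := h1 x hx
        simp only [sub_zero] at this
        have := abs_nonneg (t n x - t N x)
        linarith
  rw [sInt_add h (hd.add s hi1) hi2, sInt_add h hd hi1, sInt_ind h s.univ_mem,
    sInt_ind h hB] at h3
  have h4 : M * μ B ≤ ε / 3 := by
    have : (M + 1) * μ B < ε / 3 := by
      rw [lt_div_iff₀ (by positivity)] at h2 ⊢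
      nlinarith
    have := h.nonneg _ hB
    nlinarith
  linarith

end SimpleInt

section Integral

variable {f g k : X → ℝ}

theorem det_iff (h : IsCharge 𝒜 μ) {s : ℕ → X → ℝ} : IsDetermining 𝒜 μ s f ↔
    (∀ n, SMap 𝒜 (s n)) ∧ HazyConv 𝒜 μ s f ∧
    ∀ ε > (0 : ℝ), ∃ N, ∀ m ≥ N, ∀ n ≥ N, sIntegral μ (fun x => |s m x - s n x|) < ε := by
  constructor
  · rintro ⟨h1, h2, h3⟩
    refine ⟨fun n => SMap.of_simple h.isSetField (h1 n), h2, fun ε hε => ?_⟩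
    obtain ⟨⟨a, b⟩, hab⟩ := eventually_atTop.1 (h3.eventually (gt_mem_nhds hε))
    refine ⟨max a b, fun m hm n hn => hab (m, n) ⟨?_, ?_⟩⟩
    · exact le_of_max_le_left hm
    · exact le_of_max_le_right hn
  · rintro ⟨h1, h2, h3⟩
    refine ⟨fun n => (h1 n).simple, h2, ?_⟩
    rw [Metric.tendsto_atTop]
    intro ε hε
    obtain ⟨N, hN⟩ := h3 ε hε
    refine ⟨(N, N), fun mn hmn => ?_⟩
    rw [Real.dist_eq, sub_zero, abs_of_nonneg]
    · exact hN _ hmn.1 _ hmn.2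
    · exact sInt_nonneg h ((h1 _).dist h.isSetField (h1 _)) fun x => abs_nonneg _

theorem hazy_sub (h : IsCharge 𝒜 μ) {s t : ℕ → X → ℝ} (hs : HazyConv 𝒜 μ s f)
    (ht : HazyConv 𝒜 μ t g) : HazyConv 𝒜 μ (fun n x => s n x - t n x) (fun x => f x - g x) := by
  rw [h.hazy_iff] at hs ht ⊢
  intro ε hε δ hδ
  obtain ⟨N, hN⟩ := hs (ε / 2) (by positivity) (δ / 2) (by positivity)
  obtain ⟨M, hM⟩ := ht (ε / 2) (by positivity) (δ / 2) (by positivity)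
  refine ⟨max N M, fun n hn => ?_⟩
  obtain ⟨B, hB, hB1, hB2⟩ := hN n (le_of_max_le_left hn)
  obtain ⟨C, hC, hC1, hC2⟩ := hM n (le_of_max_le_right hn)
  refine ⟨B ∪ C, h.isSetField.union_mem _ hB _ hC, fun x hx => ?_, ?_⟩
  · simp only [mem_union, not_or] at hx
    have h1 := abs_le.1 (hB1 x hx.1)
    have h2 := abs_le.1 (hC1 x hx.2)
    rw [abs_le]
    constructor <;> linarith
  · have := h.union_le hB hC
    linarith

theorem hazy_abs (h : IsCharge 𝒜 μ) {s : ℕ → X → ℝ} (hs : HazyConv 𝒜 μ s f) :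
    HazyConv 𝒜 μ (fun n x => |s n x|) (fun x => |f x|) := by
  rw [h.hazy_iff] at hs ⊢
  intro ε hε δ hδ
  obtain ⟨N, hN⟩ := hs ε hε δ hδ
  refine ⟨N, fun n hn => ?_⟩
  obtain ⟨B, hB, hB1, hB2⟩ := hN n hn
  exact ⟨B, hB, fun x hx => (abs_abs_sub_abs_le_abs_sub _ _).trans (hB1 x hx), hB2⟩

theorem cau_sub (h : IsCharge 𝒜 μ) {s t : ℕ → X → ℝ} (hs : ∀ n, SMap 𝒜 (s n))
    (ht : ∀ n, SMap 𝒜 (t n))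
    (hs' : ∀ ε > (0 : ℝ), ∃ N, ∀ m ≥ N, ∀ n ≥ N, sIntegral μ (fun x => |s m x - s n x|) < ε)
    (ht' : ∀ ε > (0 : ℝ), ∃ N, ∀ m ≥ N, ∀ n ≥ N, sIntegral μ (fun x => |t m x - t n x|) < ε) :
    ∀ ε > (0 : ℝ), ∃ N, ∀ m ≥ N, ∀ n ≥ N,
      sIntegral μ (fun x => |(s m x - t m x) - (s n x - t n x)|) < ε := by
  intro ε hε
  have F := h.isSetField
  obtain ⟨N, hN⟩ := hs' (ε / 2) (by positivity)
  obtain ⟨M, hM⟩ := ht' (ε / 2) (by positivity)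
  refine ⟨max N M, fun m hm n hn => ?_⟩
  have h1 := hN m (le_of_max_le_left hm) n (le_of_max_le_left hn)
  have h2 := hM m (le_of_max_le_right hm) n (le_of_max_le_right hn)
  have d1 := (hs m).dist F (hs n)
  have d2 := (ht m).dist F (ht n)
  have := sInt_mono h (((hs m).sub F (ht m)).dist F ((hs n).sub F (ht n))) (d1.add F d2) fun x => by
    have := abs_sub (s m x - s n x) (t m x - t n x)
    have e : s m x - t m x - (s n x - t n x) = s m x - s n x - (t m x - t n x) := by ring
    rw [e]
    exact this
  rw [sInt_add h d1 d2] at this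
  linarith

theorem det_sub (h : IsCharge 𝒜 μ) {s t : ℕ → X → ℝ} (hs : IsDetermining 𝒜 μ s f)
    (ht : IsDetermining 𝒜 μ t g) :
    IsDetermining 𝒜 μ (fun n x => s n x - t n x) (fun x => f x - g x) := by
  rw [det_iff h] at hs ht ⊢
  exact ⟨fun n => (hs.1 n).sub h.isSetField (ht.1 n), hazy_sub h hs.2.1 ht.2.1,
    cau_sub h hs.1 ht.1 hs.2.2 ht.2.2⟩

theorem det_abs (h : IsCharge 𝒜 μ) {s : ℕ → X → ℝ} (hs : IsDetermining 𝒜 μ s f) :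
    IsDetermining 𝒜 μ (fun n x => |s n x|) (fun x => |f x|) := by
  rw [det_iff h] at hs ⊢
  refine ⟨fun n => (hs.1 n).abs, hazy_abs h hs.2.1, fun ε hε => ?_⟩
  obtain ⟨N, hN⟩ := hs.2.2 ε hε
  have F := h.isSetField
  refine ⟨N, fun m hm n hn => lt_of_le_of_lt ?_ (hN m hm n hn)⟩
  exact sInt_mono h ((hs.1 m).abs.dist F (hs.1 n).abs) ((hs.1 m).dist F (hs.1 n)) fun x =>
    abs_abs_sub_abs_le_abs_sub _ _

theorem det_const (h : IsCharge 𝒜 μ) (hf : SMap 𝒜 f) : IsDetermining 𝒜 μ (fun _ => f) f := by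
  rw [det_iff h]
  refine ⟨fun _ => hf, h.hazy_iff.2 fun ε hε δ hδ => ⟨0, fun n _ => ⟨∅, h.isSetField.empty_mem,
    fun x _ => by simpa using hε.le, by rwa [h.empty]⟩⟩, fun ε hε => ⟨0, fun m _ n _ => ?_⟩⟩
  simp only [sub_self, abs_zero]
  have := sInt_ind h h.isSetField.empty_mem 0
  simp only [ite_self, zero_mul] at this
  rwa [this]

theorem det_uniq (h : IsCharge 𝒜 μ) {s t : ℕ → X → ℝ} (hs : IsDetermining 𝒜 μ s f)
    (ht : IsDetermining 𝒜 μ t f) :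
    Tendsto (fun n => sIntegral μ (s n) - sIntegral μ (t n)) atTop (𝓝 0) := by
  have hd := (det_iff h).1 (det_sub h hs ht)
  rw [det_iff h] at hs ht
  have hz : HazyConv 𝒜 μ (fun n x => s n x - t n x) (fun _ => 0) := by
    have := hd.2.1
    simpa only [sub_self] using this
  have := key_null h hd.1 hz hd.2.2
  rw [Metric.tendsto_atTop]
  intro ε hε
  obtain ⟨N, hN⟩ := this ε hε
  refine ⟨N, fun n hn => ?_⟩
  rw [Real.dist_eq, sub_zero]
  exact (sInt_abs_sub h (hs.1 n) (ht.1 n)).trans_lt (hN n hn)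

theorem det_conv (h : IsCharge 𝒜 μ) {s : ℕ → X → ℝ} (hs : IsDetermining 𝒜 μ s f) :
    ∃ L, Tendsto (fun n => sIntegral μ (s n)) atTop (𝓝 L) := by
  rw [det_iff h] at hs
  apply cauchySeq_tendsto_of_complete
  rw [Metric.cauchySeq_iff]
  intro ε hε
  obtain ⟨N, hN⟩ := hs.2.2 ε hε
  refine ⟨N, fun m hm n hn => ?_⟩
  rw [Real.dist_eq]
  exact (sInt_abs_sub h (hs.1 m) (hs.1 n)).trans_lt (hN m hm n hn)

theorem CI_tendsto (h : IsCharge 𝒜 μ) {s : ℕ → X → ℝ} (hs : IsDetermining 𝒜 μ s f) :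
    Tendsto (fun n => sIntegral μ (s n)) atTop (𝓝 (chargeIntegral 𝒜 μ f)) := by
  have hex : ∃ fn : ℕ → X → ℝ, IsDetermining 𝒜 μ fn f := ⟨s, hs⟩
  have hu := det_uniq h hs hex.choose_spec
  obtain ⟨L, hL⟩ := det_conv h hex.choose_spec
  have : chargeIntegral 𝒜 μ f = L := by
    unfold chargeIntegral
    rw [dif_pos hex]
    exact hL.limUnder_eq
  rw [this]
  simpa using hu.add hL

theorem CI_simple (h : IsCharge 𝒜 μ) (hf : SMap 𝒜 f) : chargeIntegral 𝒜 μ f = sIntegral μ f :=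
  tendsto_nhds_unique (CI_tendsto h (det_const h hf)) tendsto_const_nhds

theorem CI_dist (h : IsCharge 𝒜 μ) {s t : ℕ → X → ℝ} (hs : IsDetermining 𝒜 μ s f)
    (ht : IsDetermining 𝒜 μ t g) :
    Tendsto (fun n => sIntegral μ (fun x => |s n x - t n x|)) atTop
      (𝓝 (chargeIntegral 𝒜 μ fun x => |f x - g x|)) :=
  CI_tendsto h (det_abs h (det_sub h hs ht))

theorem CI_tri (h : IsCharge 𝒜 μ) (hf : MemL1 𝒜 μ f) (hg : MemL1 𝒜 μ g) (hk : MemL1 𝒜 μ k) :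
    chargeIntegral 𝒜 μ (fun x => |f x - k x|) ≤ chargeIntegral 𝒜 μ (fun x => |f x - g x|) +
      chargeIntegral 𝒜 μ (fun x => |g x - k x|) := by
  obtain ⟨s, hs⟩ := hf
  obtain ⟨t, ht⟩ := hg
  obtain ⟨u, hu⟩ := hk
  refine le_of_tendsto_of_tendsto' (CI_dist h hs hu) ((CI_dist h hs ht).add (CI_dist h ht hu)) ?_
  intro n
  rw [det_iff h] at hs ht hu
  exact sInt_tri h (hs.1 n) (ht.1 n) (hu.1 n)

theorem CI_nonneg (h : IsCharge 𝒜 μ) (hf : MemL1 𝒜 μ f) (hg : MemL1 𝒜 μ g) :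
    0 ≤ chargeIntegral 𝒜 μ (fun x => |f x - g x|) := by
  obtain ⟨s, hs⟩ := hf
  obtain ⟨t, ht⟩ := hg
  refine ge_of_tendsto' (CI_dist h hs ht) fun n => ?_
  rw [det_iff h] at hs ht
  exact sInt_nonneg h ((hs.1 n).dist h.isSetField (ht.1 n)) fun x => abs_nonneg _

theorem CI_comm (f g : X → ℝ) :
    chargeIntegral 𝒜 μ (fun x => |f x - g x|) = chargeIntegral 𝒜 μ (fun x => |g x - f x|) := by
  congr 1
  funext x
  exact abs_sub_comm _ _

/-- A determining sequence converges in the pseudonorm. -/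
theorem det_norm (h : IsCharge 𝒜 μ) {s : ℕ → X → ℝ} (hs : IsDetermining 𝒜 μ s f) :
    ∀ ε > (0 : ℝ), ∃ N, ∀ m ≥ N, chargeIntegral 𝒜 μ (fun x => |s m x - f x|) < ε := by
  intro ε hε
  have hd := (det_iff h).1 hs
  obtain ⟨N, hN⟩ := hd.2.2 (ε / 2) (by positivity)
  refine ⟨N, fun m hm => lt_of_le_of_lt ?_ (half_lt_self hε)⟩
  refine le_of_tendsto (CI_dist h (det_const h (hd.1 m)) hs) ?_
  filter_upwards [eventually_ge_atTop N] with n hn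
  exact (hN m hm n hn).le

/-- The combinatorial condition equivalent to completeness. -/
def StarCond (𝒜 : Set (Set X)) (μ : Set X → ℝ) : Prop :=
  ∀ U : ℕ → Set X, (∀ n, U n ∈ 𝒜) → Monotone U → ∀ L : ℝ, (∀ n, μ (U n) ≤ L) →
    ∀ ε > (0 : ℝ), ∃ C ∈ 𝒜, (∀ n, μ (U n \ C) = 0) ∧ μ C ≤ L + ε

def L1Complete (𝒜 : Set (Set X)) (μ : Set X → ℝ) : Prop :=
  ∀ fn : ℕ → X → ℝ, (∀ n, MemL1 𝒜 μ (fn n)) →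
        (∀ ε > (0 : ℝ), ∃ N : ℕ, ∀ m ≥ N, ∀ n ≥ N,
          chargeIntegral 𝒜 μ (fun x => |fn m x - fn n x|) < ε) →
        ∃ f : X → ℝ, MemL1 𝒜 μ f ∧
          Filter.Tendsto (fun n => chargeIntegral 𝒜 μ (fun x => |fn n x - f x|))
            Filter.atTop (nhds 0)

open Classical in
theorem star_of_complete (h : IsCharge 𝒜 μ) (hc : L1Complete 𝒜 μ) : StarCond 𝒜 μ := by
  intro U hU hmono L hL ε hε
  have F := h.isSetField
  have hS : ∀ n, SMap 𝒜 (fun x => if x ∈ U n then (1 : ℝ) else 0) := fun n => SMap.ind F (hU n) 1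
  have hdist : ∀ m n, m ≤ n → sIntegral μ (fun x => |(if x ∈ U m then (1 : ℝ) else 0) -
      (if x ∈ U n then (1 : ℝ) else 0)|) = μ (U n) - μ (U m) := by
    intro m n hmn
    rw [← h.diff_of_subset (hU m) (hU n) (hmono hmn), ← one_mul (μ (U n \ U m)),
      ← sInt_ind h (F.diff_mem (hU n) (hU m)) 1]
    congr 1
    funext x
    by_cases h1 : x ∈ U m
    · have := hmono hmn h1
      simp [h1, this]
    · by_cases h2 : x ∈ U n <;> simp [h1, h2]
  have hcs : CauchySeq (fun n => μ (U n)) := by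
    refine (tendsto_atTop_ciSup (fun m n hmn => h.mono (hU m) (hU n) (hmono hmn)) ?_).cauchySeq
    exact ⟨L, by rintro _ ⟨n, rfl⟩; exact hL n⟩
  obtain ⟨f, ⟨t, ht⟩, hf⟩ := hc (fun n x => if x ∈ U n then 1 else 0)
    (fun n => ⟨_, det_const h (hS n)⟩) (by
      intro δ hδ
      obtain ⟨N, hN⟩ := Metric.cauchySeq_iff.1 hcs δ hδ
      refine ⟨N, fun m hm n hn => ?_⟩
      rw [CI_simple h ((hS m).dist F (hS n))]
      rcases le_total m n with hmn | hmn
      · rw [hdist m n hmn]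
        exact (le_abs_self _).trans_lt (hN n hn m hm)
      · have := hdist n m hmn
        simp only [abs_sub_comm] at this ⊢
        rw [this]
        exact (le_abs_self _).trans_lt (hN m hm n hn))
  have ht' := (det_iff h).1 ht
  -- a covering set for the symmetric difference
  have cover : ∀ δ > (0 : ℝ), ∃ N, ∀ n ≥ N, ∃ D ∈ 𝒜, μ D < δ ∧
      ∀ x, x ∉ D → |(if x ∈ U n then (1 : ℝ) else 0) - f x| < 1 / 2 := by
    intro δ hδ
    obtain ⟨N, hN⟩ := eventually_atTop.1 (hf.eventually (gt_mem_nhds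
      (show (0 : ℝ) < 1 / 8 * (δ / 2) by positivity)))
    obtain ⟨K, hK⟩ := h.hazy_iff.1 ht'.2.1 (1 / 8) (by norm_num) (δ / 2) (by positivity)
    refine ⟨N, fun n hn => ?_⟩
    obtain ⟨k, hk1, hk2⟩ := (((CI_dist h (det_const h (hS n)) ht).eventually
      (gt_mem_nhds (hN n hn))).and (eventually_ge_atTop K)).exists
    obtain ⟨B, hB, hB1, hB2⟩ := hK k hk2
    have hd := (hS n).sub F (ht'.1 k)
    have hch := sInt_cheb h hd (1 / 8)
    have hE : {x | (1 / 8 : ℝ) < |(if x ∈ U n then (1 : ℝ) else 0) - t k x|} ∈ 𝒜 :=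
      hd.2 {y | 1 / 8 < |y|}
    refine ⟨_, F.union_mem _ hE _ hB, ?_, fun x hx => ?_⟩
    · have := h.union_le hE hB
      linarith
    · simp only [mem_union, not_or] at hx
      have h1 := abs_le.1 (not_lt.1
        (show ¬ (1 / 8 : ℝ) < |(if x ∈ U n then (1 : ℝ) else 0) - t k x| from hx.1))
      have h2 := abs_le.1 (hB1 x hx.2)
      rw [abs_lt]
      constructor <;> linarith
  obtain ⟨N, hN⟩ := cover ε hε
  obtain ⟨D, hD, hD1, hD2⟩ := hN N le_rfl
  have hC : U N ∪ D ∈ 𝒜 := F.union_mem _ (hU N) _ hD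
  refine ⟨U N ∪ D, hC, fun n => ?_, ?_⟩
  · refine le_antisymm (le_of_forall_pos_lt_add fun δ hδ => ?_) (h.nonneg _ (F.diff_mem (hU n) hC))
    obtain ⟨M, hM⟩ := cover δ hδ
    obtain ⟨D', hD', h1, h2⟩ := hM (max M n) (le_max_left _ _)
    rw [zero_add]
    refine (h.mono (F.diff_mem (hU n) hC) hD' ?_).trans_lt h1
    rintro x ⟨hx, hx'⟩
    by_contra hc
    simp only [mem_union, not_or] at hx'
    have h3 := abs_lt.1 (h2 x hc)
    have h4 := abs_lt.1 (hD2 x hx'.2)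
    rw [if_pos (hmono (le_max_right M n) hx)] at h3
    rw [if_neg hx'.1] at h4
    linarith
  · have := h.union_le (hU N) hD
    have := hL N
    linarith

open Classical in
/-- The hazy limit of a fast Cauchy sequence of simple functions. -/
theorem star_limit (h : IsCharge 𝒜 μ) (hst : StarCond 𝒜 μ) {u : ℕ → X → ℝ}
    (hu : ∀ n, SMap 𝒜 (u n))
    (hE : ∀ n, μ {x | (1 / 2 : ℝ) ^ n < |u n x - u (n + 1) x|} ≤ (1 / 2 : ℝ) ^ n) :
    ∃ f, HazyConv 𝒜 μ u f := by
  have F := h.isSetField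
  set E : ℕ → Set X := fun n => {x | (1 / 2 : ℝ) ^ n < |u n x - u (n + 1) x|} with hEdef
  have hEm : ∀ n, E n ∈ 𝒜 := fun n =>
    ((hu n).sub F (hu (n + 1))).2 {y | (1 / 2 : ℝ) ^ n < |y|}
  have hgeo : Summable (fun n : ℕ => (1 / 2 : ℝ) ^ n) := summable_geometric_two
  have hgeok : ∀ k : ℕ, ∑' i : ℕ, (1 / 2 : ℝ) ^ (i + k) = 2 * (1 / 2 : ℝ) ^ k := by
    intro k
    simp only [pow_add]
    rw [tsum_mul_right, tsum_geometric_two]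
  have hC : ∀ k : ℕ, ∃ C ∈ 𝒜, (∀ n ≥ k, μ (E n \ C) = 0) ∧ μ C ≤ 3 * (1 / 2 : ℝ) ^ k := by
    intro k
    have hUm : ∀ n, (⋃ i ∈ Finset.range n, E (i + k)) ∈ 𝒜 := fun n =>
      F.biUnion_mem _ _ fun i _ => hEm _
    obtain ⟨C, hC, h1, h2⟩ := hst (fun n => ⋃ i ∈ Finset.range n, E (i + k)) hUm
      (fun m n hmn => biUnion_subset_biUnion_left fun i hi =>
        Finset.range_mono hmn hi) (2 * (1 / 2 : ℝ) ^ k) (fun n => by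
        refine (h.biUnion_le _ _ fun i _ => hEm _).trans ?_
        refine (Finset.sum_le_sum fun i _ => hE (i + k)).trans ?_
        rw [← hgeok k]
        exact Summable.sum_le_tsum _ (fun i _ => by positivity)
          ((summable_nat_add_iff k).2 hgeo)) ((1 / 2 : ℝ) ^ k) (by positivity)
    refine ⟨C, hC, fun n hn => ?_, by linarith⟩
    refine le_antisymm ?_ (h.nonneg _ (F.diff_mem (hEm n) hC))
    rw [← h1 (n - k + 1)]
    refine h.mono (F.diff_mem (hEm n) hC) (F.diff_mem (hUm _) hC) (sdiff_subset_sdiff_left ?_)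
    intro x hx
    simp only [mem_iUnion, Finset.mem_range, exists_prop]
    exact ⟨n - k, by omega, by rwa [Nat.sub_add_cancel hn]⟩
  choose C hCm hC0 hCle using hC
  set N : ℕ → Set X := fun n => ⋃ k ∈ Finset.range (n + 1), E n \ C k with hNdef
  have hNm : ∀ n, N n ∈ 𝒜 := fun n => F.biUnion_mem _ _ fun k _ => F.diff_mem (hEm n) (hCm k)
  have hN0 : ∀ n, μ (N n) = 0 := fun n => by
    refine le_antisymm ?_ (h.nonneg _ (hNm n))
    refine (h.biUnion_le _ _ fun k _ => F.diff_mem (hEm n) (hCm k)).trans ?_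
    refine (Finset.sum_eq_zero fun k hk => hC0 k n ?_).le
    have := Finset.mem_range.1 hk
    omega
  set g : ℕ → X → ℝ := fun n x => if x ∈ N n then 0 else u (n + 1) x - u n x with hgdef
  refine ⟨fun x => u 0 x + ∑' n, g n x, h.hazy_iff.2 fun ε hε δ hδ => ?_⟩
  obtain ⟨k, hk⟩ := exists_pow_lt_of_lt_one (show (0 : ℝ) < δ / 3 by positivity)
    (show (1 / 2 : ℝ) < 1 by norm_num)
  obtain ⟨m, hm⟩ := exists_pow_lt_of_lt_one (show (0 : ℝ) < ε / 2 by positivity)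
    (show (1 / 2 : ℝ) < 1 by norm_num)
  refine ⟨max k m, fun n hn => ?_⟩
  have hkn : k ≤ n := le_of_max_le_left hn
  have hmn : m ≤ n := le_of_max_le_right hn
  have hZm : (⋃ i ∈ Finset.range n, N i) ∈ 𝒜 := F.biUnion_mem _ _ fun i _ => hNm i
  have hZ0 : μ (⋃ i ∈ Finset.range n, N i) ≤ 0 :=
    (h.biUnion_le _ _ fun i _ => hNm i).trans (Finset.sum_eq_zero fun i _ => hN0 i).le
  refine ⟨C k ∪ ⋃ i ∈ Finset.range n, N i, F.union_mem _ (hCm k) _ hZm, fun x hx => ?_, ?_⟩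
  · simp only [mem_union, not_or, mem_iUnion, Finset.mem_range, not_exists] at hx
    obtain ⟨hxC, hxN⟩ := hx
    have hsum : ∀ j ≤ n, u j x = u 0 x + ∑ i ∈ Finset.range j, g i x := by
      intro j hj
      induction j with
      | zero => simp
      | succ j ih =>
        have e : g j x = u (j + 1) x - u j x := if_neg (hxN j hj)
        rw [Finset.sum_range_succ, ← add_assoc, ← ih (by omega), e]
        ring
    have hb : ∀ i ≥ k, |g i x| ≤ (1 / 2 : ℝ) ^ i := by
      intro i hi
      by_cases hxi : x ∈ N i
      · simp only [hgdef, if_pos hxi, abs_zero]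
        positivity
      · have hxE : x ∉ E i := by
          intro hxE
          apply hxi
          simp only [hNdef, mem_iUnion, Finset.mem_range, exists_prop]
          exact ⟨k, by omega, hxE, hxC⟩
        simp only [hgdef, if_neg hxi]
        rw [abs_sub_comm]
        exact not_lt.1 hxE
    have hbn : ∀ i, ‖g (i + n) x‖ ≤ (1 / 2 : ℝ) ^ (i + n) := fun i => hb _ (by omega)
    have hgeon : Summable (fun i : ℕ => (1 / 2 : ℝ) ^ (i + n)) := (summable_nat_add_iff n).2 hgeo
    have hsn : Summable (fun i => g (i + n) x) := Summable.of_norm_bounded hgeon hbn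
    have hs : Summable (fun i => g i x) := (summable_nat_add_iff n).1 hsn
    have e1 := hs.sum_add_tsum_nat_add n
    have e2 : ‖∑' i, g (i + n) x‖ ≤ 2 * (1 / 2 : ℝ) ^ n := by
      rw [← hgeok n]
      exact tsum_of_norm_bounded hgeon.hasSum hbn
    have e3 : (1 / 2 : ℝ) ^ n ≤ (1 / 2 : ℝ) ^ m :=
      pow_le_pow_of_le_one (by norm_num) (by norm_num) hmn
    rw [hsum n le_rfl, ← e1]
    rw [Real.norm_eq_abs] at e2
    have : u 0 x + ∑ i ∈ Finset.range n, g i x - (u 0 x + (∑ i ∈ Finset.range n, g i x +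
      ∑' i, g (i + n) x)) = - ∑' i, g (i + n) x := by ring
    rw [this, abs_neg]
    linarith
  · have := h.union_le (hCm k) hZm
    have := hCle k
    linarith

theorem complete_of_star (h : IsCharge 𝒜 μ) (hst : StarCond 𝒜 μ) : L1Complete 𝒜 μ := by
  intro fn hfn hcau
  have F := h.isSetField
  have hpos : ∀ n : ℕ, (0 : ℝ) < (1 / 2 : ℝ) ^ n * (1 / 2 : ℝ) ^ n / 3 := fun n => by positivity
  choose N hN using fun n => hcau _ (hpos n)
  -- indices
  let ix : ℕ → ℕ := fun n => ∑ i ∈ Finset.range (n + 1), (N i + 1)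
  have hixN : ∀ n, N n ≤ ix n := fun n => by
    have := Finset.single_le_sum (f := fun i => N i + 1) (fun i _ => Nat.zero_le _)
      (Finset.self_mem_range_succ n)
    exact (Nat.le_succ _).trans this
  have hixs : ∀ n, ix n ≤ ix (n + 1) := fun n => by
    simp only [ix]
    rw [Finset.sum_range_succ _ (n + 1)]
    omega
  have hixi : ∀ n, n ≤ ix n := fun n => by
    induction n with
    | zero => exact Nat.zero_le _
    | succ n ih =>
      simp only [ix] at ih ⊢
      rw [Finset.sum_range_succ _ (n + 1)]
      omega
  have happ : ∀ n, ∃ s, SMap 𝒜 s ∧ chargeIntegral 𝒜 μ (fun x => |s x - fn (ix n) x|) <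
      (1 / 2 : ℝ) ^ n * (1 / 2 : ℝ) ^ n / 3 := by
    intro n
    obtain ⟨s, hs⟩ := hfn (ix n)
    obtain ⟨M, hM⟩ := det_norm h hs _ (hpos n)
    exact ⟨s M, ((det_iff h).1 hs).1 M, hM M le_rfl⟩
  choose u hu huf using happ
  have hu1 : ∀ n, MemL1 𝒜 μ (u n) := fun n => ⟨_, det_const h (hu n)⟩
  have hq : ∀ m n, m ≤ n → (1 / 2 : ℝ) ^ n * (1 / 2 : ℝ) ^ n / 3 ≤
      (1 / 2 : ℝ) ^ m * (1 / 2 : ℝ) ^ m / 3 := by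
    intro m n hmn
    have := pow_le_pow_of_le_one (show (0 : ℝ) ≤ 1 / 2 by norm_num) (by norm_num) hmn
    gcongr
  have hixm : Monotone ix := monotone_nat_of_le_succ hixs
  have hclose : ∀ m n, m ≤ n → sIntegral μ (fun x => |u m x - u n x|) <
      (1 / 2 : ℝ) ^ m * (1 / 2 : ℝ) ^ m := by
    intro m n hmn
    rw [← CI_simple h ((hu m).dist F (hu n))]
    have t1 := CI_tri h (hu1 m) (hfn (ix m)) (hu1 n)
    have t2 := CI_tri h (hfn (ix m)) (hfn (ix n)) (hu1 n)
    have t3 := huf m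
    have t4 := huf n
    rw [CI_comm] at t4
    have t5 := hN m (ix m) (hixN m) (ix n) ((hixN m).trans (hixm hmn))
    have t6 := hq m n hmn
    linarith
  have hsmall : ∀ ε > (0 : ℝ), ∃ K : ℕ, ∀ n ≥ K, (1 / 2 : ℝ) ^ n * (1 / 2 : ℝ) ^ n < ε := by
    intro ε hε
    obtain ⟨K, hK⟩ := exists_pow_lt_of_lt_one hε (show (1 / 2 : ℝ) < 1 by norm_num)
    refine ⟨K, fun n hn => ?_⟩
    have h1 := pow_le_pow_of_le_one (show (0 : ℝ) ≤ 1 / 2 by norm_num) (by norm_num) hn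
    have h2 : (1 / 2 : ℝ) ^ n ≤ 1 := pow_le_one₀ (by norm_num) (by norm_num)
    have h3 : (0 : ℝ) < (1 / 2 : ℝ) ^ n := by positivity
    nlinarith
  obtain ⟨f, hf⟩ := star_limit h hst hu (fun n => by
    have h1 := sInt_cheb h ((hu n).sub F (hu (n + 1))) ((1 / 2 : ℝ) ^ n)
    have h2 := hclose n (n + 1) (Nat.le_succ n)
    exact le_of_mul_le_mul_left (h1.trans h2.le) (by positivity))
  have hdet : IsDetermining 𝒜 μ u f := by
    refine (det_iff h).2 ⟨hu, hf, fun ε hε => ?_⟩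
    obtain ⟨K, hK⟩ := hsmall ε hε
    refine ⟨K, fun m hm n hn => ?_⟩
    rcases le_total m n with hmn | hmn
    · exact (hclose m n hmn).trans (hK m hm)
    · simp only [abs_sub_comm (u m _)]
      exact (hclose n m hmn).trans (hK n hn)
  have hf1 : MemL1 𝒜 μ f := ⟨u, hdet⟩
  refine ⟨f, hf1, ?_⟩
  rw [Metric.tendsto_atTop]
  intro ε hε
  obtain ⟨K1, hK1⟩ := hcau (ε / 3) (by positivity)
  obtain ⟨K2, hK2⟩ := hsmall (ε / 3) (by positivity)
  obtain ⟨K3, hK3⟩ := det_norm h hdet (ε / 3) (by positivity)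
  refine ⟨K1, fun n hn => ?_⟩
  rw [Real.dist_eq, sub_zero, abs_of_nonneg (CI_nonneg h (hfn n) hf1)]
  set k := max K1 (max K2 K3) with hk
  have k1 : K1 ≤ k := le_max_left _ _
  have k2 : K2 ≤ k := (le_max_left _ _).trans (le_max_right _ _)
  have k3 : K3 ≤ k := (le_max_right _ _).trans (le_max_right _ _)
  have t1 := CI_tri h (hfn n) (hfn (ix k)) hf1
  have t2 := CI_tri h (hfn (ix k)) (hu1 k) hf1
  have t3 := hK1 n hn (ix k) (k1.trans (hixi k))
  have t4 := huf k
  rw [CI_comm] at t4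
  have t5 := hK2 k k2
  have t6 := hK3 k k3
  have t7 := hpos k
  linarith

end Integral

section PJ

theorem pj_bdd (h : IsCharge 𝒜 μ) (A : Set X) : BddAbove (μ '' {B | B ∈ 𝒜 ∧ B ⊆ A}) := by
  refine ⟨μ univ, ?_⟩
  rintro _ ⟨B, hB, rfl⟩
  exact h.mono hB.1 h.isSetField.univ_mem (subset_univ _)

theorem le_pj (h : IsCharge 𝒜 μ) {A B : Set X} (hB : B ∈ 𝒜) (hBA : B ⊆ A) :
    μ B ≤ pjCharge 𝒜 μ A := le_csSup (pj_bdd h A) ⟨B, ⟨hB, hBA⟩, rfl⟩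

theorem pj_le (h : IsCharge 𝒜 μ) {A : Set X} {z : ℝ} (hz : ∀ B ∈ 𝒜, B ⊆ A → μ B ≤ z) :
    pjCharge 𝒜 μ A ≤ z := by
  unfold pjCharge
  refine csSup_le (Set.Nonempty.image μ ⟨∅, ⟨h.isSetField.empty_mem, empty_subset _⟩⟩) ?_
  rintro _ ⟨B, hB, rfl⟩
  exact hz B hB.1 hB.2

theorem pj_eq (h : IsCharge 𝒜 μ) {A : Set X} (hA : A ∈ 𝒜) : pjCharge 𝒜 μ A = μ A :=
  le_antisymm (pj_le h fun _ hB hBA => h.mono hB hA hBA) (le_pj h hA subset_rfl)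

theorem pj_nonneg (h : IsCharge 𝒜 μ) (A : Set X) : 0 ≤ pjCharge 𝒜 μ A := by
  have := le_pj h h.isSetField.empty_mem (empty_subset A)
  rwa [h.empty] at this

theorem pj_mono (h : IsCharge 𝒜 μ) {A B : Set X} (hAB : A ⊆ B) :
    pjCharge 𝒜 μ A ≤ pjCharge 𝒜 μ B :=
  pj_le h fun _ hC hCA => le_pj h hC (hCA.trans hAB)

theorem pj_super (h : IsCharge 𝒜 μ) {A B : Set X} (hd : Disjoint A B) :
    pjCharge 𝒜 μ A + pjCharge 𝒜 μ B ≤ pjCharge 𝒜 μ (A ∪ B) := by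
  rw [← le_sub_iff_add_le]
  refine pj_le h fun C hC hCA => ?_
  rw [le_sub_comm]
  refine pj_le h fun D hD hDB => ?_
  rw [le_sub_iff_add_le, add_comm, ← h.additive C hC D hD (hd.mono hCA hDB)]
  exact le_pj h (h.isSetField.union_mem _ hC _ hD) (union_subset_union hCA hDB)

theorem pj_field (h : IsCharge 𝒜 μ) : IsSetField (pjField 𝒜 μ) := by
  have F := h.isSetField
  refine ⟨fun ε hε => ?_, fun A hA ε hε => ?_, fun A hA B hB ε hε => ?_⟩
  · exact ⟨∅, F.empty_mem, ∅, F.empty_mem, subset_rfl, subset_rfl, by simpa [h.empty] using hε⟩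
  · obtain ⟨B, hB, C, hC, h1, h2, h3⟩ := hA ε hε
    refine ⟨Cᶜ, F.compl_mem _ hC, Bᶜ, F.compl_mem _ hB, compl_subset_compl.2 h2,
      compl_subset_compl.2 h1, ?_⟩
    rwa [compl_sdiff_compl]
  · obtain ⟨B1, hB1, C1, hC1, h1, h2, h3⟩ := hA (ε / 2) (by positivity)
    obtain ⟨B2, hB2, C2, hC2, h4, h5, h6⟩ := hB (ε / 2) (by positivity)
    refine ⟨_, F.union_mem _ hB1 _ hB2, _, F.union_mem _ hC1 _ hC2, union_subset_union h1 h4,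
      union_subset_union h2 h5, ?_⟩
    have := h.mono (F.diff_mem (F.union_mem _ hC1 _ hC2) (F.union_mem _ hB1 _ hB2))
      (F.union_mem _ (F.diff_mem hC1 hB1) _ (F.diff_mem hC2 hB2)) (by
        intro x
        simp only [Set.mem_sdiff, mem_union]
        tauto)
    have := h.union_le (F.diff_mem hC1 hB1) (F.diff_mem hC2 hB2)
    linarith

/-- Covering form of the condition. -/
def CoverCond (𝒜 : Set (Set X)) (μ : Set X → ℝ) : Prop :=
  ∀ U : ℕ → Set X, (∀ n, U n ∈ 𝒜) → Monotone U → ∀ L : ℝ, (∀ n, μ (U n) ≤ L) →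
    ∀ ε > (0 : ℝ), ∃ C ∈ 𝒜, (⋃ n, U n) ⊆ C ∧ μ C ≤ L + ε

theorem pj_approx (h : IsCharge 𝒜 μ) (hc : CoverCond 𝒜 μ) (A : ℕ → Set X)
    (hA : ∀ n, A n ∈ pjField 𝒜 μ) (ε : ℝ) (hε : 0 < ε) :
    ∃ B : ℕ → Set X, (∀ n, B n ∈ 𝒜) ∧ (∀ n, B n ⊆ A n) ∧ ∃ C ∈ 𝒜, (⋃ n, A n) ⊆ C ∧
      ∃ N, μ C < μ (⋃ i ∈ Finset.range N, B i) + ε := by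
  have F := h.isSetField
  choose B hB C hC h1 h2 h3 using fun n => hA n (ε / 3 * (1 / 2 : ℝ) ^ n / 2) (by positivity)
  have hUB : ∀ n, (⋃ i ∈ Finset.range n, B i) ∈ 𝒜 := fun n => F.biUnion_mem _ _ fun i _ => hB i
  have hUC : ∀ n, (⋃ i ∈ Finset.range n, C i) ∈ 𝒜 := fun n => F.biUnion_mem _ _ fun i _ => hC i
  have hUD : ∀ n, (⋃ i ∈ Finset.range n, C i \ B i) ∈ 𝒜 := fun n =>
    F.biUnion_mem _ _ fun i _ => F.diff_mem (hC i) (hB i)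
  have hgap : ∀ n, μ (⋃ i ∈ Finset.range n, C i) ≤ μ (⋃ i ∈ Finset.range n, B i) + ε / 3 := by
    intro n
    have a1 := h.le_add_diff (hUC n) (hUB n)
    have a2 := h.mono (F.diff_mem (hUC n) (hUB n)) (hUD n) (by
      intro x
      simp only [Set.mem_sdiff, mem_iUnion, exists_prop, not_exists, not_and]
      rintro ⟨⟨i, hi, hx⟩, hx'⟩
      exact ⟨i, hi, hx, hx' i hi⟩)
    have a3 := h.biUnion_le (Finset.range n) _ fun i _ => F.diff_mem (hC i) (hB i)
    have a4 : ∑ i ∈ Finset.range n, μ (C i \ B i) ≤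
        ∑ i ∈ Finset.range n, ε / 6 * (1 / 2 : ℝ) ^ i :=
      Finset.sum_le_sum fun i _ => by have := h3 i; linarith
    rw [← Finset.mul_sum] at a4
    have a5 : ∑ i ∈ Finset.range n, (1 / 2 : ℝ) ^ i ≤ 2 := sum_geometric_two_le n
    nlinarith
  have hmB : Monotone fun n => ⋃ i ∈ Finset.range n, B i := fun m n hmn =>
    biUnion_subset_biUnion_left fun i hi => Finset.range_mono hmn hi
  have hmC : Monotone fun n => ⋃ i ∈ Finset.range n, C i := fun m n hmn =>
    biUnion_subset_biUnion_left fun i hi => Finset.range_mono hmn hi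
  have hbd : BddAbove (range fun n => μ (⋃ i ∈ Finset.range n, B i)) := by
    refine ⟨μ univ, ?_⟩
    rintro _ ⟨n, rfl⟩
    exact h.mono (hUB n) F.univ_mem (subset_univ _)
  obtain ⟨D, hD, hD1, hD2⟩ := hc _ hUC hmC ((⨆ n, μ (⋃ i ∈ Finset.range n, B i)) + ε / 3)
    (fun n => by have := hgap n; have := le_ciSup hbd n; linarith) (ε / 6) (by positivity)
  obtain ⟨N, hN⟩ := exists_lt_of_lt_ciSup (show (⨆ n, μ (⋃ i ∈ Finset.range n, B i)) - ε / 3 <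
    (⨆ n, μ (⋃ i ∈ Finset.range n, B i)) by linarith)
  refine ⟨B, hB, h1, D, hD, ?_, N, by linarith⟩
  intro x hx
  obtain ⟨n, hn⟩ := mem_iUnion.1 hx
  apply hD1
  simp only [mem_iUnion, Finset.mem_range, exists_prop]
  exact ⟨n + 1, n, by omega, h2 n hn⟩

def PJMeasure (𝒜 : Set (Set X)) (μ : Set X → ℝ) : Prop :=
  IsSetField (pjField 𝒜 μ) ∧
        (∀ A : ℕ → Set X, (∀ n, A n ∈ pjField 𝒜 μ) → (⋃ n, A n) ∈ pjField 𝒜 μ) ∧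
        (∀ A : ℕ → Set X, (∀ n, A n ∈ pjField 𝒜 μ) →
          (Pairwise fun i j => Disjoint (A i) (A j)) →
          HasSum (fun n => pjCharge 𝒜 μ (A n)) (pjCharge 𝒜 μ (⋃ n, A n)))

theorem pj_of_cover (h : IsCharge 𝒜 μ) (hc : CoverCond 𝒜 μ) : PJMeasure 𝒜 μ := by
  have F := h.isSetField
  refine ⟨pj_field h, fun A hA ε hε => ?_, fun A hA hd => ?_⟩
  · obtain ⟨B, hB, hBA, C, hC, hAC, N, hN⟩ := pj_approx h hc A hA ε hε
    have hU : (⋃ i ∈ Finset.range N, B i) ∈ 𝒜 := F.biUnion_mem _ _ fun i _ => hB i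
    have hUA : (⋃ i ∈ Finset.range N, B i) ⊆ ⋃ n, A n :=
      iUnion₂_subset fun i _ => (hBA i).trans (subset_iUnion A i)
    refine ⟨_, hU, C, hC, hUA, hAC, ?_⟩
    rw [h.diff_of_subset hU hC (hUA.trans hAC)]
    linarith
  · rw [hasSum_iff_tendsto_nat_of_nonneg fun i => pj_nonneg h _]
    have hup : ∀ n, ∑ i ∈ Finset.range n, pjCharge 𝒜 μ (A i) ≤ pjCharge 𝒜 μ (⋃ n, A n) := by
      intro n
      refine le_trans ?_ (pj_mono h (iUnion₂_subset (s := fun i (_ : i ∈ Finset.range n) => A i)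
        fun i _ => subset_iUnion A i))
      induction n with
      | zero => simpa using pj_nonneg h _
      | succ n ih =>
        have e : (⋃ i ∈ Finset.range (n + 1), A i) = (⋃ i ∈ Finset.range n, A i) ∪ A n := by
          rw [Finset.range_add_one, Finset.set_biUnion_insert, union_comm]
        rw [Finset.sum_range_succ, e]
        refine le_trans (by gcongr) (pj_super h ?_)
        simp only [disjoint_iUnion_left]
        intro i hi
        exact hd (by have := Finset.mem_range.1 hi; omega)
    rw [Metric.tendsto_atTop]
    intro ε hε
    obtain ⟨B, hB, hBA, C, hC, hAC, N, hN⟩ := pj_approx h hc A hA ε hε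
    refine ⟨N, fun n hn => ?_⟩
    rw [Real.dist_eq, abs_sub_lt_iff]
    have a1 := hup n
    have a2 : pjCharge 𝒜 μ (⋃ n, A n) ≤ μ C := pj_le h fun D hD hDA => h.mono hD hC (hDA.trans hAC)
    have a3 := h.biUnion_le (Finset.range N) B fun i _ => hB i
    have a4 : ∑ i ∈ Finset.range N, μ (B i) ≤ ∑ i ∈ Finset.range N, pjCharge 𝒜 μ (A i) :=
      Finset.sum_le_sum fun i _ => le_pj h (hB i) (hBA i)
    have a5 : ∑ i ∈ Finset.range N, pjCharge 𝒜 μ (A i) ≤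
        ∑ i ∈ Finset.range n, pjCharge 𝒜 μ (A i) :=
      Finset.sum_le_sum_of_subset_of_nonneg (Finset.range_mono hn) fun i _ _ => pj_nonneg h _
    constructor <;> linarith

theorem cover_of_pj (h : IsCharge 𝒜 μ) (hp : PJMeasure 𝒜 μ) : CoverCond 𝒜 μ := by
  intro U hU hm L hL ε hε
  have F := h.isSetField
  have sub : ∀ A ∈ 𝒜, A ∈ pjField 𝒜 μ := fun A hA δ hδ =>
    ⟨A, hA, A, hA, subset_rfl, subset_rfl, by simpa [h.empty] using hδ⟩
  obtain ⟨-, h1, h2⟩ := hp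
  obtain ⟨B, hB, C, hC, hBU, hUC, hlt⟩ := h1 U (fun n => sub _ (hU n)) ε hε
  have hsucc : ∀ n, disjointed U (n + 1) = U (n + 1) \ U n := fun n => by
    simpa using hm.disjointed_add_one n
  have hdm : ∀ n, disjointed U n ∈ 𝒜 := by
    rintro (_ | n)
    · simpa using hU 0
    · rw [hsucc]
      exact F.diff_mem (hU _) (hU _)
  have hsum := h2 (disjointed U) (fun n => sub _ (hdm n)) (disjoint_disjointed U)
  rw [iUnion_disjointed] at hsum
  have hpart : ∀ n, ∑ i ∈ Finset.range (n + 1), pjCharge 𝒜 μ (disjointed U i) = μ (U n) := by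
    intro n
    induction n with
    | zero => simp [pj_eq h (hU 0)]
    | succ n ih =>
      rw [Finset.sum_range_succ, ih, pj_eq h (hdm _), hsucc,
        h.diff_of_subset (hU _) (hU _) (hm (Nat.le_succ n))]
      ring
  have hle : pjCharge 𝒜 μ (⋃ n, U n) ≤ L := by
    refine le_of_tendsto' ((tendsto_add_atTop_iff_nat 1).2 hsum.tendsto_sum_nat) fun n => ?_
    rw [hpart]
    exact hL n
  refine ⟨C, hC, hUC, ?_⟩
  have := h.le_add_diff hC hB
  have := le_pj h hB hBU
  linarith

end PJ

end Helpers

/-- Let `ψ : 𝒜 → 𝒫(Y)` implement a representation `φ` of the quotient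
Boolean algebra `𝒜/ℳ` (`ℳ` the kernel of `μ`), i.e. `ψ A = φ [A]`: `ψ` preserves the
Boolean operations on `𝒜` and identifies `A, B ∈ 𝒜` exactly when `μ(A △ B) = 0`.
With the charge `ν(ψ A) := μ A` on `⟨𝒜⟩ = ψ '' 𝒜`, the space `L₁(X,𝒜,μ)` is
complete (w.r.t. `‖f‖₁ = ∫|f| dμ`) iff the Peano-Jordan completion of
`(Y, ⟨𝒜⟩, ν)` is a measure space: a σ-field on which the completed charge is
countably additive. -/
theorem L1_complete_iff_representation_measure_space {X Y : Type*}
    (𝒜 : Set (Set X)) (μ : Set X → ℝ) (hμ : IsCharge 𝒜 μ)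
    (ψ : Set X → Set Y)
    (hker : ∀ A ∈ 𝒜, ∀ B ∈ 𝒜, (ψ A = ψ B ↔ μ (symmDiff A B) = 0))
    (hempty : ψ ∅ = ∅) (huniv : ψ Set.univ = Set.univ)
    (hunion : ∀ A ∈ 𝒜, ∀ B ∈ 𝒜, ψ (A ∪ B) = ψ A ∪ ψ B)
    (hinter : ∀ A ∈ 𝒜, ∀ B ∈ 𝒜, ψ (A ∩ B) = ψ A ∩ ψ B)
    (hcompl : ∀ A ∈ 𝒜, ψ Aᶜ = (ψ A)ᶜ)
    (ν : Set Y → ℝ) (hν : ∀ A ∈ 𝒜, ν (ψ A) = μ A) :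
    ((∀ fn : ℕ → X → ℝ, (∀ n, MemL1 𝒜 μ (fn n)) →
        (∀ ε > (0 : ℝ), ∃ N : ℕ, ∀ m ≥ N, ∀ n ≥ N,
          chargeIntegral 𝒜 μ (fun x => |fn m x - fn n x|) < ε) →
        ∃ f : X → ℝ, MemL1 𝒜 μ f ∧
          Filter.Tendsto (fun n => chargeIntegral 𝒜 μ (fun x => |fn n x - f x|))
            Filter.atTop (nhds 0))
      ↔
      (IsSetField (pjField (ψ '' 𝒜) ν) ∧
        (∀ A : ℕ → Set Y, (∀ n, A n ∈ pjField (ψ '' 𝒜) ν) →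
          (⋃ n, A n) ∈ pjField (ψ '' 𝒜) ν) ∧
        (∀ A : ℕ → Set Y, (∀ n, A n ∈ pjField (ψ '' 𝒜) ν) →
          (Pairwise fun i j => Disjoint (A i) (A j)) →
          HasSum (fun n => pjCharge (ψ '' 𝒜) ν (A n))
            (pjCharge (ψ '' 𝒜) ν (⋃ n, A n))))) := by
  have F := hμ.isSetField
  have hdiff : ∀ A ∈ 𝒜, ∀ B ∈ 𝒜, ψ (A \ B) = ψ A \ ψ B := fun A hA B hB => by
    rw [sdiff_eq, hinter A hA _ (F.compl_mem _ hB), hcompl B hB, sdiff_eq]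
  have hnull : ∀ A ∈ 𝒜, (ψ A = ∅ ↔ μ A = 0) := fun A hA => by
    have := hker A hA ∅ F.empty_mem
    rw [hempty] at this
    rw [this, show symmDiff A ∅ = A from symmDiff_bot A]
  have hsub : ∀ A ∈ 𝒜, ∀ B ∈ 𝒜, (ψ A ⊆ ψ B ↔ μ (A \ B) = 0) := fun A hA B hB => by
    rw [← hnull _ (F.diff_mem hA hB), hdiff A hA B hB, sdiff_eq_empty]
  have hν' : IsCharge (ψ '' 𝒜) ν := by
    refine ⟨⟨⟨∅, F.empty_mem, hempty⟩, ?_, ?_⟩, ?_, ?_, ?_⟩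
    · rintro _ ⟨A, hA, rfl⟩
      exact ⟨_, F.compl_mem _ hA, hcompl A hA⟩
    · rintro _ ⟨A, hA, rfl⟩ _ ⟨B, hB, rfl⟩
      exact ⟨_, F.union_mem _ hA _ hB, hunion A hA B hB⟩
    · rw [← hempty, hν _ F.empty_mem, hμ.empty]
    · rintro _ ⟨A, hA, rfl⟩
      rw [hν A hA]
      exact hμ.nonneg A hA
    · rintro _ ⟨A, hA, rfl⟩ _ ⟨B, hB, rfl⟩ hd
      rw [← hunion A hA B hB, hν _ (F.union_mem _ hA _ hB), hν A hA, hν B hB]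
      have e : ψ (A ∩ B) = ∅ := by
        rw [hinter A hA B hB]
        exact hd.inter_eq
      rw [hnull _ (F.inter_mem hA hB), inter_comm] at e
      have h1 := hμ.additive A hA (B \ A) (F.diff_mem hB hA) disjoint_sdiff_right
      rw [union_sdiff_self] at h1
      have h2 := hμ.diff_add_inter hB hA
      linarith
  have hequiv : StarCond 𝒜 μ ↔ CoverCond (ψ '' 𝒜) ν := by
    constructor
    · intro hs U hU hm L hL ε hε
      choose V hV hVU using hU
      have hWm : ∀ n, (⋃ i ∈ Finset.range (n + 1), V i) ∈ 𝒜 := fun n =>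
        F.biUnion_mem _ _ fun i _ => hV i
      have hψW : ∀ n, ψ (⋃ i ∈ Finset.range (n + 1), V i) = U n := by
        intro n
        induction n with
        | zero => simpa using hVU 0
        | succ n ih =>
          rw [Finset.range_add_one, Finset.set_biUnion_insert,
            hunion _ (hV _) _ (hWm n), ih, hVU]
          exact union_eq_left.2 (hm (Nat.le_succ n))
      obtain ⟨C, hC, h1, h2⟩ := hs (fun n => ⋃ i ∈ Finset.range (n + 1), V i) hWm
        (fun m n hmn => biUnion_subset_biUnion_left fun i hi =>
          Finset.range_mono (Nat.succ_le_succ hmn) hi) L (fun n => by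
          rw [← hν _ (hWm n), hψW]
          exact hL n) ε hε
      refine ⟨ψ C, ⟨C, hC, rfl⟩, iUnion_subset fun n => ?_, by rwa [hν C hC]⟩
      rw [← hψW n, hsub _ (hWm n) _ hC]
      exact h1 n
    · intro hs U hU hm L hL ε hε
      obtain ⟨_, ⟨C, hC, rfl⟩, h1, h2⟩ := hs (fun n => ψ (U n)) (fun n => ⟨_, hU n, rfl⟩)
        (fun m n hmn => by
          show ψ (U m) ⊆ ψ (U n)
          rw [hsub _ (hU m) _ (hU n), sdiff_eq_empty.2 (hm hmn), hμ.empty]) L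
        (fun n => by rw [hν _ (hU n)]; exact hL n) ε hε
      refine ⟨C, hC, fun n => ?_, by rwa [hν C hC] at h2⟩
      rw [← hsub _ (hU n) _ hC]
      exact (subset_iUnion (fun n => ψ (U n)) n).trans h1
  constructor
  · intro hc
    exact pj_of_cover hν' (hequiv.1 (star_of_complete hμ hc))
  · intro hp
    exact complete_of_star hμ (hequiv.2 (cover_of_pj hν' hp))
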